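/- arXiv:0809.0457 — 2 statements merged into one kernel-verified Lean document; each statement's English description precedes it below -/
import Mathlib

section
/- Let X be a proper, geodesically complete CAT(0) space and let G be a closed, totally disconnected subgroup of Isom(X) whose action on X is minimal. Then the pointwise stabiliser in G of every bounded subset of X is an open subgroup of G; in particular the action is smooth, i.e. the stabiliser in G of every point of X is open. -/
open Metric Set Filter

universe u v

variable {X : Type u}

/-- An affinely parametrised geodesic segment from `x` to `y`, defined on `[0,1]`. -/
def IsGeodesicSeg [MetricSpace X] (x y : X) (γ : ℝ → X) : Prop :=
  γ 0 = x ∧ γ 1 = y ∧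
    ∀ s ∈ Set.Icc (0:ℝ) 1, ∀ t ∈ Set.Icc (0:ℝ) 1, dist (γ s) (γ t) = |s - t| * dist x y

/-- A CAT(0) space: a geodesic metric space in which every geodesic triangle is at least as
thin as its Euclidean comparison triangle, expressed via the standard comparison
(convexity) inequality along geodesics. -/
class CAT0Space (X : Type u) [MetricSpace X] : Prop where
  exists_geodesic : ∀ x y : X, ∃ γ : ℝ → X, IsGeodesicSeg x y γ
  comparison : ∀ (p x y : X) (γ : ℝ → X), IsGeodesicSeg x y γ → ∀ t ∈ Set.Icc (0:ℝ) 1,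
    dist p (γ t) ^ 2 ≤ (1 - t) * dist p x ^ 2 + t * dist p y ^ 2 - t * (1 - t) * dist x y ^ 2

/-- A subset is (geodesically) convex if it contains every geodesic segment between
any two of its points. -/
def GeoConvex [MetricSpace X] (C : Set X) : Prop :=
  ∀ x ∈ C, ∀ y ∈ C, ∀ γ : ℝ → X, IsGeodesicSeg x y γ → ∀ t ∈ Set.Icc (0:ℝ) 1, γ t ∈ C

/-- Every geodesic segment of positive length extends to a locally isometric embedding
of the whole real line. -/
def GeodesicallyComplete (X : Type u) [MetricSpace X] : Prop :=
  ∀ x y : X, x ≠ y → ∀ γ : ℝ → X, IsGeodesicSeg x y γ →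
    ∃ ℓ : ℝ → X,
      (∀ t : ℝ, ∃ ε > (0:ℝ), ∀ s₁ ∈ Set.Ioo (t - ε) (t + ε), ∀ s₂ ∈ Set.Ioo (t - ε) (t + ε),
        dist (ℓ s₁) (ℓ s₂) = |s₁ - s₂|) ∧
      ∀ t ∈ Set.Icc (0:ℝ) 1, ℓ (t * dist x y) = γ t

/-- A (unit speed) geodesic ray, parametrised by `[0,∞)`. -/
structure GeodesicRay (X : Type u) [MetricSpace X] where
  toFun : ℝ → X
  isom : ∀ s, 0 ≤ s → ∀ t, 0 ≤ t → dist (toFun s) (toFun t) = |s - t|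

/-- Two rays are asymptotic if they remain at bounded distance. -/
def GeodesicRay.Asymp [MetricSpace X] (ρ σ : GeodesicRay X) : Prop :=
  ∃ C : ℝ, ∀ t, 0 ≤ t → dist (ρ.toFun t) (σ.toFun t) ≤ C

theorem GeodesicRay.asymp_equivalence (X : Type u) [MetricSpace X] :
    Equivalence (GeodesicRay.Asymp (X := X)) where
  refl ρ := ⟨0, fun t _ => by simp⟩
  symm := fun {ρ σ} ⟨C, hC⟩ => ⟨C, fun t ht => by rw [dist_comm]; exact hC t ht⟩
  trans := fun {ρ σ τ} ⟨C₁, h₁⟩ ⟨C₂, h₂⟩ =>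
    ⟨C₁ + C₂, fun t ht => (dist_triangle (ρ.toFun t) (σ.toFun t) (τ.toFun t)).trans
      (add_le_add (h₁ t ht) (h₂ t ht))⟩

instance GeodesicRay.setoid (X : Type u) [MetricSpace X] : Setoid (GeodesicRay X) :=
  ⟨GeodesicRay.Asymp, GeodesicRay.asymp_equivalence X⟩

/-- The boundary at infinity: asymptote classes of geodesic rays. -/
def Boundary (X : Type u) [MetricSpace X] : Type u := Quotient (GeodesicRay.setoid X)

/-- The boundary point determined by a ray. -/
def GeodesicRay.cls [MetricSpace X] (ρ : GeodesicRay X) : Boundary X := Quotient.mk _ ρ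

/-- The boundary at infinity of a subset `Y ⊆ X`: classes of rays staying within
bounded distance of `Y`. -/
def boundarySet [MetricSpace X] (Y : Set X) : Set (Boundary X) :=
  {ξ | ∃ ρ : GeodesicRay X, ρ.cls = ξ ∧ ∃ C : ℝ, ∀ t, 0 ≤ t → ∃ y ∈ Y, dist (ρ.toFun t) y ≤ C}

/-- Composition of a ray with an isometric map. -/
def GeodesicRay.comp [MetricSpace X] (f : X → X) (hf : Isometry f) (ρ : GeodesicRay X) :
    GeodesicRay X :=
  ⟨fun t => f (ρ.toFun t), fun s hs t ht => by simpa [hf.dist_eq] using ρ.isom s hs t ht⟩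

/-- The induced map of an isometric map on the boundary at infinity. -/
def Boundary.map [MetricSpace X] (f : X → X) (hf : Isometry f) : Boundary X → Boundary X :=
  Quotient.map (GeodesicRay.comp f hf)
    (fun ρ σ h => by
      obtain ⟨C, hC⟩ := h
      exact ⟨C, fun t ht => by simpa [GeodesicRay.comp, hf.dist_eq] using hC t ht⟩)

/-- The Euclidean comparison angle at `p` of the points `x, y`. -/
noncomputable def cmpAngle [MetricSpace X] (p x y : X) : ℝ :=
  Real.arccos ((dist p x ^ 2 + dist p y ^ 2 - dist x y ^ 2) / (2 * dist p x * dist p y))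

/-- The Alexandrov angle between two geodesic rays issuing from the same point
(in a CAT(0) space, the comparison angles are monotone, so the limit defining the
Alexandrov angle is the infimum of comparison angles). -/
noncomputable def alexAngleRays [MetricSpace X] (ρ σ : ℝ → X) : ℝ :=
  sInf {a | ∃ s, 0 < s ∧ ∃ t, 0 < t ∧ a = cmpAngle (ρ 0) (ρ s) (σ t)}

/-- The Alexandrov angle between two geodesic segments (parametrised on `[0,1]`)
issuing from the same point. -/
noncomputable def alexAngleSegs [MetricSpace X] (γ δ : ℝ → X) : ℝ :=
  sInf {a | ∃ s ∈ Set.Ioc (0:ℝ) 1, ∃ t ∈ Set.Ioc (0:ℝ) 1, a = cmpAngle (γ 0) (γ s) (δ t)}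

/-- The Tits angle between two boundary points: the supremum over basepoints of the
Alexandrov angle between the rays issuing from that basepoint representing them. -/
noncomputable def titsAngle [MetricSpace X] (ξ η : Boundary X) : ℝ :=
  sSup {a | ∃ ρ σ : GeodesicRay X, ρ.toFun 0 = σ.toFun 0 ∧ ρ.cls = ξ ∧ σ.cls = η ∧
    a = alexAngleRays ρ.toFun σ.toFun}

/-- The circumradius of `Z` within `Y`, with respect to the distance function `d`. -/
noncomputable def circumradiusIn {B : Type v} (d : B → B → ℝ) (Y Z : Set B) : ℝ :=
  sInf ((fun y => sSup ((fun z => d y z) '' Z)) '' Y)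

/-- The topology of the Tits boundary, generated by the balls of the Tits angle metric. -/
instance boundaryTopology (X : Type u) [MetricSpace X] : TopologicalSpace (Boundary X) :=
  TopologicalSpace.generateFrom
    {U | ∃ (ξ : Boundary X) (r : ℝ), U = {η | titsAngle ξ η < r}}

/-- Lebesgue covering dimension of a subset `K` is at most `n`: every open cover of `K`
admits an open refinement covering `K` of multiplicity at most `n+1` on `K`. -/
def CovDimSubsetLE {B : Type v} [TopologicalSpace B] (K : Set B) (n : ℕ) : Prop :=
  ∀ 𝒰 : Set (Set B), (∀ U ∈ 𝒰, IsOpen U) → K ⊆ ⋃₀ 𝒰 →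
    ∃ 𝒱 : Set (Set B), (∀ V ∈ 𝒱, IsOpen V) ∧ K ⊆ ⋃₀ 𝒱 ∧
      (∀ V ∈ 𝒱, ∃ U ∈ 𝒰, V ⊆ U) ∧
      ∀ x ∈ K, {V | V ∈ 𝒱 ∧ x ∈ V}.Finite ∧ {V | V ∈ 𝒱 ∧ x ∈ V}.ncard ≤ n + 1

/-- The Tits boundary is finite-dimensional: the topological dimension of compact
subsets of the Tits boundary is bounded. -/
def FiniteDimTitsBoundary (X : Type u) [MetricSpace X] : Prop :=
  ∃ n : ℕ, ∀ K : Set (Boundary X), IsCompact K → CovDimSubsetLE K n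

/-- The topology of uniform convergence on compacta (compact-open topology) on the
isometry group of `X`. -/
instance isomEquivTopology (X : Type u) [MetricSpace X] : TopologicalSpace (X ≃ᵢ X) :=
  TopologicalSpace.induced (fun g : X ≃ᵢ X => (⟨⇑g, g.continuous⟩ : C(X, X)))
    ContinuousMap.compactOpen

/-- A subgroup of the isometry group acts minimally: there is no nonempty proper closed
convex invariant subset. -/
def MinimalSubgroupAction [MetricSpace X] (G : Subgroup (X ≃ᵢ X)) : Prop :=
  ∀ C : Set X, C.Nonempty → IsClosed C → GeoConvex C →
    (∀ g ∈ G, ∀ x ∈ C, g x ∈ C) → C = Set.univ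

section SMulNotions
variable {G : Type v} [Group G] [MulAction G X] [MetricSpace X]

/-- The translation length of `g`. -/
noncomputable def transLength (g : G) : ℝ := sInf (Set.range fun x : X => dist (g • x) x)

/-- `g` acts as an elliptic isometry: it fixes a point. -/
def IsEllipticSMul (g : G) : Prop := ∃ x : X, g • x = x

/-- `g` acts as a hyperbolic isometry: its translation length is positive and attained. -/
def IsHyperbolicSMul (g : G) : Prop :=
  ∃ x : X, dist (g • x) x = transLength (X := X) g ∧ 0 < dist (g • x) x

end SMulNotions

/-- The Busemann function associated with a geodesic ray, based at `ρ 0`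
(the limit exists, hence agrees with the `limsup`). -/
noncomputable def busemann [MetricSpace X] (ρ : GeodesicRay X) (y : X) : ℝ :=
  Filter.limsup (fun t : ℝ => dist (ρ.toFun t) y - dist (ρ.toFun t) (ρ.toFun 0)) Filter.atTop

/-- Convergence of a sequence to a boundary point in the cône topology (in a CAT(0)
space): the sequence escapes to infinity and the geodesics from the basepoint `p` to the
points of the sequence converge pointwise to the ray from `p` representing `η`. -/
def SeqTendstoBoundary [MetricSpace X] (p : X) (u : ℕ → X) (η : Boundary X) : Prop :=
  Filter.Tendsto (fun n => dist p (u n)) Filter.atTop Filter.atTop ∧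
  ∃ σ : GeodesicRay X, σ.toFun 0 = p ∧ σ.cls = η ∧
    ∀ γ : ℕ → ℝ → X, (∀ n, IsGeodesicSeg p (u n) (γ n)) →
      ∀ t, 0 ≤ t →
        Filter.Tendsto (fun n => γ n (t / dist p (u n))) Filter.atTop (nhds (σ.toFun t))

/-- The closed convex hull of a subset. -/
def closedGeoConvexHull [MetricSpace X] (S : Set X) : Set X :=
  ⋂₀ {C : Set X | IsClosed C ∧ GeoConvex C ∧ S ⊆ C}

/-- A real function is convex if its restriction to every geodesic is convex. -/
def ConvexFun [MetricSpace X] (f : X → ℝ) : Prop :=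
  ∀ (x y : X) (γ : ℝ → X), IsGeodesicSeg x y γ →
    ∀ s ∈ Set.Icc (0:ℝ) 1, ∀ t ∈ Set.Icc (0:ℝ) 1, ∀ a b : ℝ, 0 ≤ a → 0 ≤ b → a + b = 1 →
      f (γ (a * s + b * t)) ≤ a * f (γ s) + b * f (γ t)

/-- `X` is boundary-minimal: no proper closed convex subset has full boundary. -/
def BoundaryMinimal (X : Type u) [MetricSpace X] : Prop :=
  ∀ Y : Set X, IsClosed Y → GeoConvex Y → boundarySet Y = boundarySet (Set.univ : Set X) →
    Y = Set.univ

/-- A geodesic segment with respect to an abstract distance function `d`. -/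
def IsGeodesicSegD {B : Type v} (d : B → B → ℝ) (x y : B) (γ : ℝ → B) : Prop :=
  γ 0 = x ∧ γ 1 = y ∧
    ∀ s ∈ Set.Icc (0:ℝ) 1, ∀ t ∈ Set.Icc (0:ℝ) 1, d (γ s) (γ t) = |s - t| * d x y

/-- Convexity with respect to an abstract distance function `d`. -/
def DConvex {B : Type v} (d : B → B → ℝ) (A : Set B) : Prop :=
  ∀ x ∈ A, ∀ y ∈ A, ∀ γ : ℝ → B, IsGeodesicSegD d x y γ → ∀ t ∈ Set.Icc (0:ℝ) 1, γ t ∈ A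

/-- `X` is irreducible: it admits no isometric splitting as an (ℓ²-)product with both
factors containing more than one point. -/
def IrreducibleCAT0 (X : Type u) [MetricSpace X] : Prop :=
  ¬ ∃ (A : Type u) (B : Type u) (_ : MetricSpace A) (_ : MetricSpace B)
      (_ : X ≃ᵢ WithLp 2 (A × B)), Nontrivial A ∧ Nontrivial B

/-- The forward ray of a geodesic line. -/
def GeodesicRay.ofLineFwd [MetricSpace X] (ℓ : ℝ → X)
    (h : ∀ s t : ℝ, dist (ℓ s) (ℓ t) = |s - t|) : GeodesicRay X :=
  ⟨ℓ, fun s _ t _ => h s t⟩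

/-- The backward ray of a geodesic line. -/
def GeodesicRay.ofLineBwd [MetricSpace X] (ℓ : ℝ → X)
    (h : ∀ s t : ℝ, dist (ℓ s) (ℓ t) = |s - t|) : GeodesicRay X :=
  ⟨fun t => ℓ (-t), fun s _ t _ => by
    rw [h (-s) (-t), show (-s) - (-t) = -(s - t) by ring, abs_neg]⟩

/-- Two boundary points are opposite if they are the two endpoints of a geodesic line. -/
def OppositeBd [MetricSpace X] (ξ η : Boundary X) : Prop :=
  ∃ (ℓ : ℝ → X) (h : ∀ s t : ℝ, dist (ℓ s) (ℓ t) = |s - t|),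
    (GeodesicRay.ofLineBwd ℓ h).cls = ξ ∧ (GeodesicRay.ofLineFwd ℓ h).cls = η

/-- An isometry is parabolic if its displacement function does not attain its infimum. -/
def IsParabolicIsom [MetricSpace X] (g : X ≃ᵢ X) : Prop :=
  ¬ ∃ x : X, dist (g x) x = sInf (Set.range fun y : X => dist (g y) y)

/-- The fixed-point set of an isometry in the boundary at infinity. -/
def boundaryFixedSet [MetricSpace X] (g : X ≃ᵢ X) : Set (Boundary X) :=
  {ξ | Boundary.map (⇑g) g.isometry ξ = ξ}


section GeodesicConvexity

variable [MetricSpace X]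

theorem IsGeodesicSeg.reverse {a b : X} {γ : ℝ → X} (hγ : IsGeodesicSeg a b γ) :
    IsGeodesicSeg b a (fun t => γ (1 - t)) := by
  refine ⟨by simpa using hγ.2.1, by simpa using hγ.1, fun s hs t ht => ?_⟩
  rw [hγ.2.2 (1 - s) ⟨by linarith [hs.2], by linarith [hs.1]⟩ (1 - t)
    ⟨by linarith [ht.2], by linarith [ht.1]⟩, dist_comm b a, abs_sub_comm]
  congr 2
  ring

theorem IsGeodesicSeg.isometryEquiv {a b : X} {γ : ℝ → X} (hγ : IsGeodesicSeg a b γ)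
    (g : X ≃ᵢ X) : IsGeodesicSeg (g a) (g b) (fun t => g (γ t)) :=
  ⟨congrArg g hγ.1, congrArg g hγ.2.1, fun s hs t ht => by
    rw [g.dist_eq, g.dist_eq]; exact hγ.2.2 s hs t ht⟩

variable [CAT0Space X]

/-- Convexity of the metric for two geodesics with a common endpoint. -/
theorem IsGeodesicSeg.dist_le_of_common_end {a a' b : X} {γ δ : ℝ → X}
    (hγ : IsGeodesicSeg a b γ) (hδ : IsGeodesicSeg a' b δ) {t : ℝ} (ht : t ∈ Set.Icc (0:ℝ) 1) :
    dist (γ t) (δ t) ≤ (1 - t) * dist a a' := by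
  have h1 := CAT0Space.comparison (γ t) a' b δ hδ t ht
  have h2 := CAT0Space.comparison a' a b γ hγ t ht
  have h3 : dist (γ t) b = (1 - t) * dist a b := by
    have := hγ.2.2 t ht 1 (by simp)
    rw [hγ.2.1, abs_sub_comm, abs_of_nonneg (by linarith [ht.2])] at this
    exact this
  rw [h3] at h1
  rw [dist_comm a' (γ t), dist_comm a' a] at h2
  refine abs_le_of_sq_le_sq' ?_ (mul_nonneg (by linarith [ht.2]) dist_nonneg) |>.2
  nlinarith [mul_le_mul_of_nonneg_left h2 (show 0 ≤ 1 - t by linarith [ht.2])]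

/-- Convexity of the metric of a CAT(0) space. -/
theorem IsGeodesicSeg.dist_le {a a' b b' : X} {γ δ : ℝ → X}
    (hγ : IsGeodesicSeg a b γ) (hδ : IsGeodesicSeg a' b' δ) {t : ℝ}
    (ht : t ∈ Set.Icc (0:ℝ) 1) :
    dist (γ t) (δ t) ≤ (1 - t) * dist a a' + t * dist b b' := by
  obtain ⟨σ, hσ⟩ := CAT0Space.exists_geodesic a' b
  have h1 := hγ.dist_le_of_common_end hσ ht
  have h2 := hσ.reverse.dist_le_of_common_end hδ.reverse (t := 1 - t)
    ⟨by linarith [ht.2], by linarith [ht.1]⟩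
  simp only [sub_sub_cancel] at h2
  linarith [dist_triangle (γ t) (σ t) (δ t)]

theorem IsGeodesicSeg.eq_of_mem {a b : X} {γ δ : ℝ → X}
    (hγ : IsGeodesicSeg a b γ) (hδ : IsGeodesicSeg a b δ) {t : ℝ}
    (ht : t ∈ Set.Icc (0:ℝ) 1) : γ t = δ t := by
  have := hγ.dist_le hδ ht
  simp only [dist_self, mul_zero, add_zero] at this
  exact dist_le_zero.1 this

/-- An isometry fixing the endpoints of a geodesic segment fixes it pointwise. -/
theorem IsGeodesicSeg.isometryEquiv_apply_eq {a b : X} {γ : ℝ → X} (hγ : IsGeodesicSeg a b γ)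
    {g : X ≃ᵢ X} (ha : g a = a) (hb : g b = b) {t : ℝ} (ht : t ∈ Set.Icc (0:ℝ) 1) :
    g (γ t) = γ t := by
  have h := hγ.isometryEquiv g
  rw [ha, hb] at h
  exact h.eq_of_mem hγ ht

theorem GeoConvex.closure {C : Set X} (hC : GeoConvex C) : GeoConvex (closure C) := by
  intro x hx y hy γ hγ t ht
  rw [Metric.mem_closure_iff] at hx hy ⊢
  intro ε hε
  obtain ⟨x', hx', hxx'⟩ := hx ε hε
  obtain ⟨y', hy', hyy'⟩ := hy ε hε
  obtain ⟨δ, hδ⟩ := CAT0Space.exists_geodesic x' y'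
  refine ⟨δ t, hC x' hx' y' hy' δ hδ t ht, (hγ.dist_le hδ ht).trans_lt ?_⟩
  rcases ht.1.eq_or_lt with rfl | h0
  · simpa using hxx'
  · nlinarith [mul_lt_mul_of_pos_left hyy' h0,
      mul_le_mul_of_nonneg_left hxx'.le (show 0 ≤ 1 - t by linarith [ht.2])]

/-- The distance to a closed convex set is midpoint-convex along geodesics. -/
theorem GeoConvex.infDist_midpoint_le [ProperSpace X] {C : Set X} (hC : GeoConvex C)
    (hcl : IsClosed C) (hne : C.Nonempty) {a b : X} {γ : ℝ → X} (hγ : IsGeodesicSeg a b γ) :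
    infDist (γ (1 / 2)) C ≤ (infDist a C + infDist b C) / 2 := by
  obtain ⟨a', ha', haa'⟩ := hcl.exists_infDist_eq_dist hne a
  obtain ⟨b', hb', hbb'⟩ := hcl.exists_infDist_eq_dist hne b
  obtain ⟨δ, hδ⟩ := CAT0Space.exists_geodesic a' b'
  have ht : (1 / 2 : ℝ) ∈ Set.Icc (0:ℝ) 1 := by norm_num
  have h := (infDist_le_dist_of_mem (x := γ (1 / 2)) (hC a' ha' b' hb' δ hδ _ ht)).trans
    (hγ.dist_le hδ ht)
  rw [haa', hbb']
  linarith

end GeodesicConvexity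

section LocalGeodesics

variable [MetricSpace X] {ℓ : ℝ → X}

/-- A local geodesic, in the sense of `GeodesicallyComplete`. -/
def IsLocalGeodesic (ℓ : ℝ → X) : Prop :=
  ∀ t : ℝ, ∃ ε > (0:ℝ), ∀ s₁ ∈ Set.Ioo (t - ε) (t + ε), ∀ s₂ ∈ Set.Ioo (t - ε) (t + ε),
    dist (ℓ s₁) (ℓ s₂) = |s₁ - s₂|

theorem IsLocalGeodesic.continuous (hℓ : IsLocalGeodesic ℓ) : Continuous ℓ := by
  refine continuous_iff_continuousAt.2 fun t => ?_
  obtain ⟨ε, hε, h⟩ := hℓ t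
  rw [ContinuousAt, tendsto_iff_dist_tendsto_zero]
  have h0 : Tendsto (fun s : ℝ => |s - t|) (nhds t) (nhds 0) := by
    have : Continuous fun s : ℝ => |s - t| := by fun_prop
    simpa using this.tendsto t
  refine h0.congr' ?_
  filter_upwards [Ioo_mem_nhds (show t - ε < t by linarith) (show t < t + ε by linarith)] with s hs
  exact (h s hs t ⟨by linarith, by linarith⟩).symm

theorem IsLocalGeodesic.dist_le (hℓ : IsLocalGeodesic ℓ) {a b : ℝ} (hab : a ≤ b) :
    dist (ℓ a) (ℓ b) ≤ b - a := by
  have hc := hℓ.continuous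
  have key : Set.Icc a b ⊆ {t | dist (ℓ a) (ℓ t) ≤ t - a} := by
    refine IsClosed.Icc_subset_of_forall_exists_gt ?_ (by simp) ?_
    · exact (isClosed_le (by fun_prop) (by fun_prop)).inter isClosed_Icc
    · rintro t ⟨ht, -⟩ y hy
      obtain ⟨ε, hε, h⟩ := hℓ t
      have hy : t < y := hy
      refine ⟨min y (t + ε / 2), ?_, lt_min hy (by linarith), min_le_left _ _⟩
      have h1 : t < min y (t + ε / 2) := lt_min hy (by linarith)
      have h2 := min_le_right y (t + ε / 2)
      have h3 := h t ⟨by linarith, by linarith⟩ (min y (t + ε / 2)) ⟨by linarith, by linarith⟩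
      rw [abs_sub_comm, abs_of_pos (by linarith)] at h3
      have ht : dist (ℓ a) (ℓ t) ≤ t - a := ht
      show dist (ℓ a) (ℓ (min y (t + ε / 2))) ≤ min y (t + ε / 2) - a
      linarith [dist_triangle (ℓ a) (ℓ t) (ℓ (min y (t + ε / 2)))]
  exact key (right_mem_Icc.2 hab)

/-- A local geodesic leaving a closed convex set along a shortest path never comes closer
to it again. -/
theorem IsLocalGeodesic.le_infDist [ProperSpace X] [CAT0Space X] (hℓ : IsLocalGeodesic ℓ)
    {C : Set X} (hC : GeoConvex C) (hcl : IsClosed C) (h0 : ℓ 0 ∈ C) {d : ℝ} (hd : 0 < d)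
    (hdC : d ≤ infDist (ℓ d) C) {t : ℝ} (ht : d ≤ t) : t ≤ infDist (ℓ t) C := by
  have hc := hℓ.continuous
  have key : Set.Icc d t ⊆ {t | t ≤ infDist (ℓ t) C} := by
    refine IsClosed.Icc_subset_of_forall_exists_gt ?_ hdC ?_
    · exact (isClosed_le continuous_id ((continuous_infDist_pt C).comp hc)).inter isClosed_Icc
    · rintro T ⟨hT, hTm⟩ y hy
      have hT : T ≤ infDist (ℓ T) C := hT
      have hy : T < y := hy
      obtain ⟨ε, hε, h⟩ := hℓ T
      obtain ⟨η, hη, hη1, hη2, hη3⟩ : ∃ η : ℝ, 0 < η ∧ η < ε ∧ T + η ≤ y ∧ η ≤ T := by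
        refine ⟨min (ε / 2) (min (y - T) d), lt_min (by linarith) (lt_min (by linarith) hd), ?_, ?_, ?_⟩
        · linarith [min_le_left (ε / 2) (min (y - T) d)]
        · linarith [min_le_right (ε / 2) (min (y - T) d), min_le_left (y - T) d]
        · linarith [min_le_right (ε / 2) (min (y - T) d), min_le_right (y - T) d, hTm.1]
      refine ⟨T + η, ?_, by linarith, hη2⟩
      have hγ : IsGeodesicSeg (ℓ (T - η)) (ℓ (T + η)) (fun s => ℓ (T - η + 2 * η * s)) := by
        have hmem : ∀ s ∈ Set.Icc (0:ℝ) 1, T - η + 2 * η * s ∈ Set.Ioo (T - ε) (T + ε) :=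
          fun s hs => ⟨by nlinarith [hs.1], by nlinarith [hs.2]⟩
        refine ⟨by simp, by ring_nf, fun s hs t ht => ?_⟩
        rw [h _ (hmem s hs) _ (hmem t ht), h (T - η) ⟨by linarith, by linarith⟩ (T + η)
          ⟨by linarith, by linarith⟩, ← abs_mul, ← abs_neg]
        rw [show -(T - η + 2 * η * s - (T - η + 2 * η * t)) = (s - t) * (T - η - (T + η)) by ring]
      have h1 := hC.infDist_midpoint_le hcl ⟨_, h0⟩ hγ
      simp only [show T - η + 2 * η * (1 / 2) = T by ring] at h1
      have h2 := (infDist_le_dist_of_mem (x := ℓ (T - η)) h0).trans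
        ((dist_comm _ _).trans_le (hℓ.dist_le (sub_nonneg.2 hη3)))
      show T + η ≤ infDist (ℓ (T + η)) C
      linarith
  exact key (right_mem_Icc.2 ht)

/-- In a geodesically complete space, a closed convex set that is sufficiently dense in a ball
contains a slightly smaller ball. -/
theorem GeodesicallyComplete.closedBall_subset [ProperSpace X] [CAT0Space X]
    (hgc : GeodesicallyComplete X) {C : Set X} (hC : GeoConvex C) (hcl : IsClosed C)
    (hne : C.Nonempty) {x₀ : X} {R : ℝ}
    (hdense : ∀ x ∈ closedBall x₀ (R + 1), infDist x C < 1) : closedBall x₀ R ⊆ C := by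
  intro x hx
  by_contra hxC
  obtain ⟨p, hp, hxp⟩ := hcl.exists_infDist_eq_dist hne x
  have hpx : p ≠ x := fun h => hxC (h ▸ hp)
  obtain ⟨γ, hγ⟩ := CAT0Space.exists_geodesic p x
  obtain ⟨ℓ, hℓ, hℓγ⟩ := hgc p x hpx γ hγ
  have hℓ : IsLocalGeodesic ℓ := hℓ
  have hℓ0 : ℓ 0 = p := by simpa [hγ.1] using hℓγ 0 (by simp)
  have hℓd : ℓ (dist p x) = x := by simpa [hγ.2.1] using hℓγ 1 (by simp)
  have hd1 : dist p x < 1 := by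
    rw [dist_comm, ← hxp]
    exact hdense x (closedBall_subset_closedBall (by linarith) hx)
  have h1 : 1 ≤ infDist (ℓ 1) C :=
    hℓ.le_infDist hC hcl (hℓ0 ▸ hp) (dist_pos.2 hpx)
      (by rw [hℓd, hxp, dist_comm]) hd1.le
  refine absurd (hdense (ℓ 1) ?_) (not_lt.2 h1)
  have h2 := hℓ.dist_le hd1.le
  rw [hℓd] at h2
  rw [mem_closedBall] at hx ⊢
  linarith [dist_triangle (ℓ 1) x x₀, dist_comm x (ℓ 1), dist_nonneg (x := p) (y := x)]

end LocalGeodesics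

section BruhatTits

/-- A group of isometries of a proper CAT(0) space with a bounded orbit has a fixed point. -/
theorem exists_fixed_point_of_bounded_orbit [MetricSpace X] [ProperSpace X] [CAT0Space X]
    (H : Subgroup (X ≃ᵢ X)) {x₀ : X} {R : ℝ} (hR : ∀ h ∈ H, dist (h x₀) x₀ ≤ R) :
    ∃ c : X, ∀ h ∈ H, h c = c := by
  set r : X → ℝ := fun x => ⨆ h : H, dist ((h : X ≃ᵢ X) x₀) x with hr
  have hbdd : ∀ x, BddAbove (range fun h : H => dist ((h : X ≃ᵢ X) x₀) x) := by
    refine fun x => ⟨R + dist x₀ x, ?_⟩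
    rintro _ ⟨h, rfl⟩
    exact (dist_triangle _ x₀ _).trans (by linarith [hR h h.2])
  have hle : ∀ x (h : H), dist ((h : X ≃ᵢ X) x₀) x ≤ r x := fun x h => le_ciSup (hbdd x) h
  have hlip : ∀ x y, r x ≤ r y + dist x y := fun x y =>
    ciSup_le fun h => (dist_triangle_right _ _ _).trans
      (by linarith [hle y h, dist_triangle_right ((h : X ≃ᵢ X) x₀) x y,
        dist_triangle ((h : X ≃ᵢ X) x₀) y x, dist_comm x y])
  have hcont : Continuous r := (LipschitzWith.of_le_add hlip).continuous
  have h0 : ∀ x, dist x₀ x ≤ r x := fun x => hle x 1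
  obtain ⟨c, -, hc⟩ := (isCompact_closedBall x₀ (r x₀)).exists_isMinOn
    ⟨x₀, mem_closedBall_self (dist_nonneg.trans (h0 x₀))⟩ hcont.continuousOn
  have hmin : ∀ x, r c ≤ r x := by
    intro x
    by_cases hx : x ∈ closedBall x₀ (r x₀)
    · exact hc hx
    · rw [mem_closedBall, not_le, dist_comm] at hx
      exact (hc (mem_closedBall_self (dist_nonneg.trans (h0 x₀)))).trans
        (hx.le.trans (h0 x))
  refine ⟨c, fun g hg => ?_⟩
  have hgc : r (g c) ≤ r c := ciSup_le fun h => by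
    have := hle c ⟨g⁻¹ * h, H.mul_mem (H.inv_mem hg) h.2⟩
    rwa [← g.dist_eq, IsometryEquiv.mul_apply, IsometryEquiv.apply_inv_self] at this
  obtain ⟨γ, hγ⟩ := CAT0Space.exists_geodesic c (g c)
  have hrc : 0 ≤ r c := dist_nonneg.trans (h0 c)
  have hm : r (γ (1 / 2)) ≤ √(r c ^ 2 - dist c (g c) ^ 2 / 4) := ciSup_le fun h => by
    refine Real.le_sqrt_of_sq_le ?_
    have h1 := CAT0Space.comparison ((h : X ≃ᵢ X) x₀) c (g c) γ hγ (1 / 2) (by norm_num)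
    have h2 := pow_le_pow_left₀ dist_nonneg (hle c h) 2
    have h3 := pow_le_pow_left₀ dist_nonneg ((hle (g c) h).trans hgc) 2
    linarith
  have h4 := (hmin _).trans hm
  by_contra hne
  have hpos : 0 < dist c (g c) := dist_pos.2 (Ne.symm hne)
  rcases hrc.eq_or_lt with h5 | h5
  · have h6 := h0 (g c)
    have : dist x₀ c = 0 := le_antisymm ((h0 c).trans h5.ge) dist_nonneg
    have : dist x₀ (g c) = 0 := le_antisymm ((h6.trans hgc).trans h5.ge) dist_nonneg
    linarith [dist_triangle_left c (g c) x₀]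
  · rw [Real.le_sqrt' h5] at h4
    nlinarith

end BruhatTits

section IsometryGroupTopology

variable [MetricSpace X]

theorem IsometryEquiv.tendsto_nhds_iff {ι : Type*} {l : Filter ι} {f : ι → X ≃ᵢ X}
    {g : X ≃ᵢ X} : Tendsto f l (nhds g) ↔ ∀ x, Tendsto (fun i => f i x) l (nhds (g x)) := by
  have hind : Topology.IsInducing (fun g : X ≃ᵢ X => (⟨⇑g, g.continuous⟩ : C(X, X))) := ⟨rfl⟩
  rw [hind.tendsto_nhds_iff]
  refine ⟨fun h x => ((ContinuousEvalConst.continuous_eval_const (F := C(X, X)) x).tendsto _).comp h, fun h => ?_⟩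
  rw [ContinuousMap.tendsto_iff_forall_isCompact_tendstoUniformlyOn]
  intro K hK
  rw [Metric.tendstoUniformlyOn_iff]
  intro ε hε
  obtain ⟨t, -, htf, hKt⟩ := hK.finite_cover_balls (show 0 < ε / 3 by linarith)
  have h1 : ∀ᶠ i in l, ∀ y ∈ t, dist (f i y) (g y) < ε / 3 :=
    (htf.eventually_all).2 fun y _ => Metric.tendsto_nhds.1 (h y) _ (by linarith)
  filter_upwards [h1] with i hi x hx
  obtain ⟨y, hy, hxy⟩ := mem_iUnion₂.1 (hKt hx)
  rw [mem_ball] at hxy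
  have h2 := hi y hy
  have h3 := (f i).dist_eq x y
  have h4 := g.dist_eq x y
  show dist (g x) (f i x) < ε
  linarith [dist_triangle4 (g x) (g y) (f i y) (f i x), dist_comm (g y) (f i y),
    dist_comm (f i y) (f i x)]

theorem IsometryEquiv.continuous_eval_const (x : X) : Continuous fun g : X ≃ᵢ X => g x :=
  continuous_iff_continuousAt.2 fun _ => IsometryEquiv.tendsto_nhds_iff.1 tendsto_id x

theorem IsometryEquiv.isTopologicalGroup : IsTopologicalGroup (X ≃ᵢ X) where
  continuous_mul := by
    refine continuous_iff_continuousAt.2 fun ⟨g, h⟩ => IsometryEquiv.tendsto_nhds_iff.2 fun x => ?_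
    rw [tendsto_iff_dist_tendsto_zero]
    have hg := tendsto_iff_dist_tendsto_zero.1
      (((IsometryEquiv.continuous_eval_const (h x)).comp continuous_fst).tendsto (g, h))
    have hh := tendsto_iff_dist_tendsto_zero.1
      (((IsometryEquiv.continuous_eval_const x).comp continuous_snd).tendsto (g, h))
    refine squeeze_zero (fun _ => dist_nonneg) (fun p => ?_) (by simpa using hh.add hg)
    simp only [IsometryEquiv.mul_apply]
    refine (dist_triangle _ (p.1 (h x)) _).trans ?_
    rw [p.1.dist_eq]
  continuous_inv := by
    refine continuous_iff_continuousAt.2 fun g => IsometryEquiv.tendsto_nhds_iff.2 fun x => ?_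
    rw [tendsto_iff_dist_tendsto_zero]
    refine (tendsto_iff_dist_tendsto_zero.1
      ((IsometryEquiv.continuous_eval_const (g⁻¹ x)).tendsto g)).congr fun f => ?_
    rw [← f.dist_eq (f⁻¹ x), IsometryEquiv.apply_inv_self, IsometryEquiv.apply_inv_self, dist_comm]

attribute [local instance] IsometryEquiv.isTopologicalGroup

/-- The pair consisting of an isometry and its inverse, as a pair of functions. -/
def IsometryEquiv.toFunPair (g : X ≃ᵢ X) : (X → X) × (X → X) := (⇑g, ⇑g⁻¹)

theorem IsometryEquiv.isClosedEmbedding_toFunPair :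
    Topology.IsClosedEmbedding (IsometryEquiv.toFunPair (X := X)) := by
  refine ⟨⟨Topology.isInducing_iff_nhds.2 fun g => le_antisymm ?_ ?_, fun g h hgh => ?_⟩, ?_⟩
  · refine map_le_iff_le_comap.1 ?_
    have h1 : Continuous fun g : X ≃ᵢ X => (⇑g : X → X) :=
      continuous_pi IsometryEquiv.continuous_eval_const
    exact (h1.prodMk (h1.comp continuous_inv)).tendsto g
  · have h1 : Tendsto (IsometryEquiv.toFunPair (X := X))
      (comap IsometryEquiv.toFunPair (nhds g.toFunPair)) (nhds g.toFunPair) := tendsto_comap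
    refine tendsto_id'.1 (IsometryEquiv.tendsto_nhds_iff.2 fun x => ?_)
    exact (((continuous_apply x).comp continuous_fst).tendsto _).comp h1
  · exact DFunLike.coe_injective (congrArg Prod.fst hgh)
  · have : range (IsometryEquiv.toFunPair (X := X)) =
        {p | ∀ x y, dist (p.1 x) y = dist x (p.2 y)} := by
      ext p
      constructor
      · rintro ⟨g, rfl⟩ x y
        show dist (g x) y = dist x (g⁻¹ y)
        rw [← g.dist_eq x, IsometryEquiv.apply_inv_self]
      · intro hp
        have hl : Function.LeftInverse p.2 p.1 := fun x => by
          rw [← dist_eq_zero, dist_comm, ← hp, dist_self]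
        have hr : Function.RightInverse p.2 p.1 := fun x => by
          rw [← dist_eq_zero, hp, dist_self]
        refine ⟨⟨⟨p.1, p.2, hl, hr⟩, Isometry.of_dist_eq fun x y => ?_⟩, rfl⟩
        show dist (p.1 x) (p.1 y) = dist x y
        rw [hp, hl]
    rw [this]
    simp only [ofPred_forall]
    exact isClosed_iInter fun x => isClosed_iInter fun y =>
      isClosed_eq (by fun_prop) (by fun_prop)

theorem IsometryEquiv.isCompact_dist_le [ProperSpace X] (x₀ : X) (R : ℝ) :
    IsCompact {g : X ≃ᵢ X | dist (g x₀) x₀ ≤ R} := by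
  let A : Set (X → X) := univ.pi fun x => closedBall x₀ (R + dist x x₀)
  have hA : IsCompact A := isCompact_univ_pi fun x => isCompact_closedBall _ _
  refine (IsometryEquiv.isClosedEmbedding_toFunPair.isCompact_preimage
    (hA.prod hA)).of_isClosed_subset ?_ ?_
  · exact isClosed_le ((IsometryEquiv.continuous_eval_const x₀).dist continuous_const)
      continuous_const
  · intro g hg
    have hg : dist (g x₀) x₀ ≤ R := hg
    refine ⟨fun x _ => ?_, fun x _ => ?_⟩
    · show dist (g x) x₀ ≤ _
      linarith [dist_triangle (g x) (g x₀) x₀, g.dist_eq x x₀]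
    · show dist (g⁻¹ x) x₀ ≤ _
      rw [← g.dist_eq, IsometryEquiv.apply_inv_self]
      linarith [dist_triangle x x₀ (g x₀), dist_comm x₀ (g x₀)]

end IsometryGroupTopology

/-- In a totally disconnected locally compact group, every neighbourhood of `1` contains an
open subgroup. -/
theorem exists_isOpen_subgroup_subset_of_mem_nhds_one {G : Type*} [Group G] [TopologicalSpace G]
    [IsTopologicalGroup G] [LocallyCompactSpace G] [T2Space G] [TotallyDisconnectedSpace G]
    {U : Set G} (hU : U ∈ nhds (1 : G)) :
    ∃ H : Subgroup G, IsOpen (H : Set G) ∧ (H : Set G) ⊆ U := by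
  obtain ⟨K, hK1, hKU, hKc⟩ := local_compact_nhds hU
  obtain ⟨W, hW, h1W, hWK⟩ := (loc_compact_Haus_tot_disc_of_zero_dim (H := G)).mem_nhds_iff.1 hK1
  have hW : IsClopen W := hW
  obtain ⟨V, hV, hWV⟩ := compact_open_separated_mul_right
    (hKc.of_isClosed_subset hW.1 hWK) hW.2 subset_rfl
  let H : Subgroup G :=
    { carrier := {g | ∀ w, w * g ∈ W ↔ w ∈ W}
      one_mem' := fun w => by simp
      mul_mem' := fun {a b} ha hb w => by rw [← mul_assoc, hb, ha]
      inv_mem' := fun {a} ha w => by rw [← ha, inv_mul_cancel_right] }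
  refine ⟨H, H.isOpen_of_mem_nhds (g := 1) ?_, fun g hg => hKU (hWK ?_)⟩
  · filter_upwards [hV, inv_mem_nhds_one G hV] with g hg hg' w
    refine ⟨fun h => ?_, fun h => hWV (mul_mem_mul h hg)⟩
    simpa using hWV (mul_mem_mul h hg')
  · simpa using (hg 1).2 h1W

section Smoothness

variable [MetricSpace X]

/-- The pointwise stabiliser in `G` of a set. -/
def pointwiseStabilizer (G : Subgroup (X ≃ᵢ X)) (B : Set X) : Subgroup G where
  carrier := {g : G | ∀ x ∈ B, (g : X ≃ᵢ X) x = x}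
  one_mem' := fun _ _ => rfl
  mul_mem' := fun {a b} ha hb x hx => by
    show (a : X ≃ᵢ X) ((b : X ≃ᵢ X) x) = x
    rw [hb x hx, ha x hx]
  inv_mem' := fun {a} ha x hx => by
    show (a : X ≃ᵢ X)⁻¹ x = x
    conv_lhs => rw [← ha x hx]
    exact IsometryEquiv.inv_apply_self _ _

attribute [local instance] IsometryEquiv.isTopologicalGroup

/-- The points with open stabiliser. -/
def smoothPoints (G : Subgroup (X ≃ᵢ X)) : Set X :=
  {x | IsOpen (pointwiseStabilizer G {x} : Set G)}

theorem geoConvex_smoothPoints [CAT0Space X] (G : Subgroup (X ≃ᵢ X)) :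
    GeoConvex (smoothPoints G) := by
  intro x hx y hy γ hγ t ht
  refine Subgroup.isOpen_mono
    (H₁ := pointwiseStabilizer G {x} ⊓ pointwiseStabilizer G {y}) ?_ (IsOpen.inter hx hy)
  rintro g ⟨hgx, hgy⟩ _ rfl
  exact hγ.isometryEquiv_apply_eq (hgx x rfl) (hgy y rfl) ht

theorem apply_mem_smoothPoints {G : Subgroup (X ≃ᵢ X)} {g : X ≃ᵢ X} (hg : g ∈ G) {x : X}
    (hx : x ∈ smoothPoints G) : g x ∈ smoothPoints G := by
  have hcont : Continuous fun k : G => (⟨g, hg⟩ : G)⁻¹ * k * ⟨g, hg⟩ := by fun_prop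
  have hx : IsOpen (pointwiseStabilizer G {x} : Set G) := hx
  show IsOpen (pointwiseStabilizer G {g x} : Set G)
  convert hx.preimage hcont using 1
  ext k
  have h1 : k ∈ pointwiseStabilizer G {g x} ↔ (k : X ≃ᵢ X) (g x) = g x :=
    ⟨fun h => h _ rfl, fun h y hy => by rw [mem_singleton_iff.1 hy]; exact h⟩
  have h2 : (⟨g, hg⟩ : G)⁻¹ * k * ⟨g, hg⟩ ∈ pointwiseStabilizer G {x} ↔
      g⁻¹ ((k : X ≃ᵢ X) (g x)) = x :=
    ⟨fun h => h _ rfl, fun h y hy => by rw [mem_singleton_iff.1 hy]; exact h⟩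
  rw [mem_preimage, SetLike.mem_coe, SetLike.mem_coe, h1, h2]
  constructor
  · intro h
    rw [h, IsometryEquiv.inv_apply_self]
  · intro h
    rw [← g.apply_inv_self ((k : X ≃ᵢ X) (g x)), h]

theorem smoothPoints_nonempty [ProperSpace X] [CAT0Space X] [Nonempty X]
    {G : Subgroup (X ≃ᵢ X)} (hGclosed : IsClosed (G : Set (X ≃ᵢ X)))
    [TotallyDisconnectedSpace G] : (smoothPoints G).Nonempty := by
  obtain ⟨x₀⟩ := ‹Nonempty X›
  have : T2Space (X ≃ᵢ X) := IsometryEquiv.isClosedEmbedding_toFunPair.isEmbedding.t2Space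
  have hK : IsCompact {g : G | dist ((g : X ≃ᵢ X) x₀) x₀ ≤ 1} :=
    hGclosed.isClosedEmbedding_subtypeVal.isCompact_preimage
      (IsometryEquiv.isCompact_dist_le x₀ 1)
  have hcont : Continuous fun g : G => dist ((g : X ≃ᵢ X) x₀) x₀ :=
    ((IsometryEquiv.continuous_eval_const x₀).comp continuous_subtype_val).dist continuous_const
  have hnhds : {g : G | dist ((g : X ≃ᵢ X) x₀) x₀ ≤ 1} ∈ nhds (1 : G) := by
    filter_upwards [(isOpen_Iio.preimage hcont).mem_nhds
      (show (1 : G) ∈ _ ⁻¹' Iio (1 : ℝ) by simp)] with g hg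
    exact le_of_lt hg
  have := hK.locallyCompactSpace_of_mem_nhds_of_group hnhds
  obtain ⟨H, hHo, hH⟩ := exists_isOpen_subgroup_subset_of_mem_nhds_one hnhds
  obtain ⟨c, hc⟩ := exists_fixed_point_of_bounded_orbit (H.map G.subtype) (x₀ := x₀) (R := 1) (by
    rintro _ ⟨h, hh, rfl⟩
    exact hH hh)
  refine ⟨c, Subgroup.isOpen_mono (H₁ := H) ?_ hHo⟩
  rintro h hh _ rfl
  exact hc _ ⟨h, hh, rfl⟩

theorem isOpen_pointwiseStabilizer [ProperSpace X] [CAT0Space X]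
    (hgc : GeodesicallyComplete X) {G : Subgroup (X ≃ᵢ X)}
    (hGclosed : IsClosed (G : Set (X ≃ᵢ X))) [TotallyDisconnectedSpace G]
    (hmin : MinimalSubgroupAction G) {B : Set X} (hB : Bornology.IsBounded B) :
    IsOpen (pointwiseStabilizer G B : Set G) := by
  rcases B.eq_empty_or_nonempty with rfl | ⟨x₀, hx₀⟩
  · convert isOpen_univ
    exact eq_univ_of_forall fun g x hx => hx.elim
  have : Nonempty X := ⟨x₀⟩
  have hdense : closure (smoothPoints G) = univ := by
    refine hmin _ (smoothPoints_nonempty hGclosed).closure isClosed_closure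
      (geoConvex_smoothPoints G).closure fun g hg x hx => ?_
    exact map_mem_closure g.continuous hx fun y hy => apply_mem_smoothPoints hg hy
  obtain ⟨R, hR⟩ := hB.subset_closedBall x₀
  obtain ⟨t, ht⟩ := (isCompact_closedBall x₀ (R + 1)).elim_finite_subcover
    (fun y : smoothPoints G => ball (y : X) 1) (fun _ => isOpen_ball) (fun x _ => by
      obtain ⟨y, hy, hxy⟩ := Metric.mem_closure_iff.1 (hdense.ge (mem_univ x)) 1 one_pos
      exact mem_iUnion.2 ⟨⟨y, hy⟩, hxy⟩)
  let Q : Subgroup G := ⨅ y ∈ t, pointwiseStabilizer G {(y : X)}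
  have hQ : IsOpen (Q : Set G) := by
    simp only [Q, Subgroup.coe_iInf]
    exact isOpen_biInter_finset fun y _ => y.2
  let C : Set X := {x | ∀ q ∈ Q, (q : X ≃ᵢ X) x = x}
  have hCcl : IsClosed C := by
    simp only [C, ofPred_forall]
    exact isClosed_iInter fun q => isClosed_iInter fun _ =>
      isClosed_eq (q : X ≃ᵢ X).continuous continuous_id
  have hCconv : GeoConvex C := fun x hx y hy γ hγ s hs q hq =>
    hγ.isometryEquiv_apply_eq (hx q hq) (hy q hq) hs
  have htC : ∀ y ∈ t, (y : X) ∈ C := fun y hy q hq =>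
    (Subgroup.mem_iInf.1 (Subgroup.mem_iInf.1 hq y) hy) y rfl
  have hcover : ∀ x ∈ closedBall x₀ (R + 1), ∃ y ∈ C, dist x y < 1 := fun x hx => by
    obtain ⟨y, hy, hxy⟩ := mem_iUnion₂.1 (ht hx)
    exact ⟨y, htC y hy, hxy⟩
  have hR0 : 0 ≤ R := by simpa using hR hx₀
  obtain ⟨z, hz, -⟩ := hcover x₀ (mem_closedBall_self (by linarith))
  have hsub := hgc.closedBall_subset hCconv hCcl ⟨z, hz⟩ (x₀ := x₀) (R := R) fun x hx => by
    obtain ⟨y, hy, hxy⟩ := hcover x hx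
    exact (infDist_le_dist_of_mem hy).trans_lt hxy
  exact Subgroup.isOpen_mono (H₁ := Q) (fun q hq x hx => hsub (hR hx) q hq) hQ

end Smoothness

/-- smoothness of minimal actions of totally disconnected closed
subgroups of the isometry group on proper geodesically complete CAT(0) spaces. -/
theorem stmt0 (X : Type u) [MetricSpace X] [ProperSpace X] [CAT0Space X]
    (hgc : GeodesicallyComplete X)
    (G : Subgroup (X ≃ᵢ X)) (hGclosed : IsClosed (G : Set (X ≃ᵢ X)))
    (hGtd : TotallyDisconnectedSpace G)
    (hmin : MinimalSubgroupAction G) :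
    (∀ B : Set X, Bornology.IsBounded B →
      IsOpen {g : G | ∀ x ∈ B, (g : X ≃ᵢ X) x = x}) ∧
    ∀ x : X, IsOpen {g : G | (g : X ≃ᵢ X) x = x} := by
  have hopen := fun (B : Set X) (hB : Bornology.IsBounded B) =>
    isOpen_pointwiseStabilizer hgc hGclosed hmin hB
  refine ⟨hopen, fun x => ?_⟩
  convert hopen {x} Bornology.isBounded_singleton using 1
  ext g
  exact ⟨fun h y hy => by rw [mem_singleton_iff.1 hy]; exact h, fun h => h x rfl⟩
end

section
/- Let X be a proper CAT(0) space, ξ ∈ ∂X, and B a closed horoball centred at ξ. Then the boundary at infinity ∂B of B coincides with the closed ball of radius π/2 centred at ξ in ∂X with respect to the Tits angle metric. -/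
open Metric Set Filter

universe u v

variable {X : Type u}

section Busemann

variable [MetricSpace X]

theorem GeodesicRay.dist_zero (ρ : GeodesicRay X) {t : ℝ} (ht : 0 ≤ t) :
    dist (ρ.toFun t) (ρ.toFun 0) = t := by
  rw [ρ.isom t ht 0 le_rfl, sub_zero, abs_of_nonneg ht]

theorem tendsto_busemann (ρ : GeodesicRay X) (y : X) :
    Tendsto (fun t : ℝ => dist (ρ.toFun t) y - t) atTop (nhds (busemann ρ y)) := by
  have hanti : Antitone fun t : ℝ => dist (ρ.toFun (max t 0)) y - max t 0 := by
    intro s t hst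
    have hm : max s 0 ≤ max t 0 := max_le_max_right 0 hst
    have h := dist_triangle (ρ.toFun (max t 0)) (ρ.toFun (max s 0)) y
    rw [ρ.isom _ (le_max_right _ _) _ (le_max_right _ _), abs_of_nonneg (sub_nonneg.2 hm)] at h
    dsimp only
    linarith
  have hbdd : BddBelow (range fun t : ℝ => dist (ρ.toFun (max t 0)) y - max t 0) := by
    refine ⟨-dist (ρ.toFun 0) y, ?_⟩
    rintro _ ⟨t, rfl⟩
    have h := dist_triangle_right (ρ.toFun (max t 0)) (ρ.toFun 0) y
    rw [ρ.dist_zero (le_max_right _ _)] at h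
    dsimp only
    linarith
  have hlim := tendsto_atTop_ciInf hanti hbdd
  have h₁ : Tendsto (fun t : ℝ => dist (ρ.toFun t) y - t) atTop
      (nhds (⨅ t : ℝ, (dist (ρ.toFun (max t 0)) y - max t 0))) := by
    refine hlim.congr' ?_
    filter_upwards [eventually_ge_atTop (0 : ℝ)] with t ht
    rw [max_eq_left ht]
  have h₂ : Tendsto (fun t : ℝ => dist (ρ.toFun t) y - dist (ρ.toFun t) (ρ.toFun 0)) atTop
      (nhds (⨅ t : ℝ, (dist (ρ.toFun (max t 0)) y - max t 0))) := by
    refine h₁.congr' ?_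
    filter_upwards [eventually_ge_atTop (0 : ℝ)] with t ht
    rw [ρ.dist_zero ht]
  rw [busemann, h₂.limsup_eq]
  exact h₁

theorem busemann_le (ρ : GeodesicRay X) (y : X) {t : ℝ} (ht : 0 ≤ t) :
    busemann ρ y ≤ dist (ρ.toFun t) y - t := by
  refine le_of_tendsto (tendsto_busemann ρ y) ?_
  filter_upwards [eventually_ge_atTop t] with s hs
  have h := dist_triangle (ρ.toFun s) (ρ.toFun t) y
  rw [ρ.isom s (ht.trans hs) t ht, abs_of_nonneg (sub_nonneg.2 hs)] at h
  linarith

theorem busemann_le_add_dist (ρ : GeodesicRay X) (x y : X) :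
    busemann ρ y ≤ busemann ρ x + dist x y := by
  refine le_of_tendsto_of_tendsto' (tendsto_busemann ρ y)
    ((tendsto_busemann ρ x).add_const (dist x y)) fun t => ?_
  have h := dist_triangle (ρ.toFun t) x y
  linarith

theorem continuous_busemann (ρ : GeodesicRay X) : Continuous (busemann ρ) := by
  have h : LipschitzWith 1 (busemann ρ) := LipschitzWith.of_le_add fun x y => by
    simpa only [dist_comm] using busemann_le_add_dist ρ y x
  exact h.continuous

end Busemann

section Angles

variable [MetricSpace X]

theorem cmpAngle_set_bddBelow (ρ σ : ℝ → X) :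
    BddBelow {a | ∃ s, 0 < s ∧ ∃ t, 0 < t ∧ a = cmpAngle (ρ 0) (ρ s) (σ t)} := by
  refine ⟨0, ?_⟩
  rintro _ ⟨s, -, t, -, rfl⟩
  exact Real.arccos_nonneg _

theorem alexAngleRays_le_cmpAngle (ρ σ : ℝ → X) {s t : ℝ} (hs : 0 < s) (ht : 0 < t) :
    alexAngleRays ρ σ ≤ cmpAngle (ρ 0) (ρ s) (σ t) :=
  csInf_le (cmpAngle_set_bddBelow ρ σ) ⟨s, hs, t, ht, rfl⟩

theorem alexAngleRays_le_pi (ρ σ : ℝ → X) : alexAngleRays ρ σ ≤ Real.pi :=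
  (alexAngleRays_le_cmpAngle ρ σ one_pos one_pos).trans (Real.arccos_le_pi _)

theorem alexAngleRays_le_titsAngle (ρ σ : GeodesicRay X) (h : ρ.toFun 0 = σ.toFun 0) :
    alexAngleRays ρ.toFun σ.toFun ≤ titsAngle ρ.cls σ.cls := by
  refine le_csSup ⟨Real.pi, ?_⟩ ⟨ρ, σ, h, rfl, rfl, rfl⟩
  rintro _ ⟨ρ', σ', -, -, -, rfl⟩
  exact alexAngleRays_le_pi _ _

theorem cmpAngle_rays (ρ σ : GeodesicRay X) (h : ρ.toFun 0 = σ.toFun 0) {s t : ℝ}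
    (hs : 0 < s) (ht : 0 < t) :
    cmpAngle (ρ.toFun 0) (ρ.toFun s) (σ.toFun t) =
      Real.arccos ((s ^ 2 + t ^ 2 - dist (ρ.toFun s) (σ.toFun t) ^ 2) / (2 * s * t)) := by
  rw [cmpAngle, dist_comm _ (ρ.toFun s), ρ.dist_zero hs.le, h, dist_comm _ (σ.toFun t),
    σ.dist_zero ht.le]

/-- If the angle is larger than `π / 2`, the law of cosines gives a linear divergence. -/
theorem exists_sq_add_le_of_pi_div_two_lt (ρ σ : GeodesicRay X) (h : ρ.toFun 0 = σ.toFun 0)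
    (hang : Real.pi / 2 < alexAngleRays ρ.toFun σ.toFun) :
    ∃ δ > 0, ∀ s > 0, ∀ t > 0,
      s ^ 2 + t ^ 2 + 2 * s * t * δ ≤ dist (ρ.toFun s) (σ.toFun t) ^ 2 := by
  obtain ⟨m, hm₁, hm₂⟩ := exists_between hang
  have hmpi : m < Real.pi := hm₂.trans_le (alexAngleRays_le_pi _ _)
  have hpi := Real.pi_pos
  refine ⟨-Real.cos m, ?_, fun s hs t ht => ?_⟩
  · have := Real.cos_neg_of_pi_div_two_lt_of_lt hm₁ (by linarith)
    linarith
  · have h₁ := hm₂.trans_le (alexAngleRays_le_cmpAngle ρ.toFun σ.toFun hs ht)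
    rw [cmpAngle_rays ρ σ h hs ht, ← Real.arccos_cos (by linarith : 0 ≤ m) hmpi.le] at h₁
    have h₂ := lt_of_not_ge fun hle => h₁.not_ge (Real.antitone_arccos hle)
    rw [div_lt_iff₀ (by positivity)] at h₂
    linarith

/-- If the angle is at most `π / 2`, some comparison triangle is almost acute. -/
theorem exists_dist_sq_le_of_le_pi_div_two (ρ σ : GeodesicRay X) (h : ρ.toFun 0 = σ.toFun 0)
    (hang : alexAngleRays ρ.toFun σ.toFun ≤ Real.pi / 2) {ε : ℝ} (hε : 0 < ε) :
    ∃ s > 0, ∃ t > 0,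
      dist (ρ.toFun s) (σ.toFun t) ^ 2 ≤ s ^ 2 + t ^ 2 + 2 * s * t * ε := by
  have hlt : alexAngleRays ρ.toFun σ.toFun < Real.arccos (-ε) := by
    rw [Real.arccos, Real.arcsin_neg]
    have := Real.arcsin_pos.2 hε
    linarith
  obtain ⟨_, ⟨s, hs, t, ht, rfl⟩, hst⟩ := exists_lt_of_csInf_lt
    (⟨_, 1, one_pos, 1, one_pos, rfl⟩ : {a | ∃ s, 0 < s ∧ ∃ t, 0 < t ∧
      a = cmpAngle (ρ.toFun 0) (ρ.toFun s) (σ.toFun t)}.Nonempty) hlt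
  rw [cmpAngle_rays ρ σ h hs ht] at hst
  have h₂ := lt_of_not_ge fun hle => hst.not_ge (Real.antitone_arccos hle)
  rw [lt_div_iff₀ (by positivity)] at h₂
  exact ⟨s, hs, t, ht, by linarith⟩

end Angles

section Rays

variable [MetricSpace X]

theorem GeodesicRay.isGeodesicSeg (ρ : GeodesicRay X) {a b : ℝ} (ha : 0 ≤ a) (hab : a ≤ b) :
    IsGeodesicSeg (ρ.toFun a) (ρ.toFun b) fun t => ρ.toFun (a + t * (b - a)) := by
  have hba : 0 ≤ b - a := sub_nonneg.2 hab
  refine ⟨by simp, by simp, fun s hs t ht => ?_⟩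
  rw [ρ.isom _ (add_nonneg ha (mul_nonneg hs.1 hba)) _ (add_nonneg ha (mul_nonneg ht.1 hba)),
    ρ.isom a ha b (ha.trans hab), abs_sub_comm a b, abs_of_nonneg hba, ← abs_of_nonneg hba,
    ← abs_mul, abs_of_nonneg hba]
  congr 1
  ring

/-- The tail of a geodesic ray. -/
def GeodesicRay.shift (σ : GeodesicRay X) (t : ℝ) (ht : 0 ≤ t) : GeodesicRay X :=
  ⟨fun r => σ.toFun (t + r), fun s hs r hr => by
    rw [σ.isom _ (add_nonneg ht hs) _ (add_nonneg ht hr), add_sub_add_left_eq_sub]⟩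

theorem GeodesicRay.cls_shift (σ : GeodesicRay X) (t : ℝ) (ht : 0 ≤ t) :
    (σ.shift t ht).cls = σ.cls := by
  refine Quotient.sound ⟨t, fun r hr => ?_⟩
  change dist (σ.toFun (t + r)) (σ.toFun r) ≤ t
  rw [σ.isom _ (add_nonneg ht hr) _ hr, add_sub_cancel_right, abs_of_nonneg ht]

/-- Geodesics with a common endpoint contract towards it. -/
theorem IsGeodesicSeg.dist_le_of_common_end_s4 [CAT0Space X] {x y z : X} {γ δ : ℝ → X}
    (hγ : IsGeodesicSeg x z γ) (hδ : IsGeodesicSeg y z δ) {t : ℝ} (ht : t ∈ Icc (0 : ℝ) 1) :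
    dist (γ t) (δ t) ≤ dist x y := by
  have h₁ := CAT0Space.comparison (γ t) y z δ hδ t ht
  have h₂ := CAT0Space.comparison y x z γ hγ t ht
  have h₃ : dist (γ t) z = (1 - t) * dist x z := by
    rw [← hγ.2.1, hγ.2.2 t ht 1 ⟨zero_le_one, le_rfl⟩, hγ.2.1, abs_sub_comm,
      abs_of_nonneg (sub_nonneg.2 ht.2)]
  have h₄ := mul_le_mul_of_nonneg_left h₂ (sub_nonneg.2 ht.2)
  rw [h₃, dist_comm (γ t) y] at h₁
  rw [dist_comm y x] at h₄
  have h₅ : dist (γ t) (δ t) ^ 2 ≤ ((1 - t) * dist x y) ^ 2 := by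
    linarith
  have h₆ := abs_le_of_sq_le_sq h₅ (mul_nonneg (sub_nonneg.2 ht.2) dist_nonneg)
  have h₇ := mul_nonneg ht.1 (dist_nonneg (x := x) (y := y))
  linarith [(le_abs_self _).trans h₆]

/-- From any point of a proper CAT(0) space there is a ray asymptotic to a given one, along which
the Busemann function decreases at unit speed. -/
theorem exists_asymptotic_ray [ProperSpace X] [CAT0Space X] (ρ : GeodesicRay X) (q : X) :
    ∃ σ : GeodesicRay X, σ.toFun 0 = q ∧ σ.cls = ρ.cls ∧
      ∀ s, 0 ≤ s → busemann ρ (σ.toFun s) ≤ busemann ρ q - s := by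
  choose γ hγ using fun n : ℕ => CAT0Space.exists_geodesic q (ρ.toFun n)
  set U : Ultrafilter ℕ := hyperfilter ℕ
  have hU : (U : Filter ℕ) ≤ atTop := by
    rw [← Nat.cofinite_eq_atTop]; exact hyperfilter_le_cofinite
  have hmem : ∀ s : ℝ, 0 ≤ s → ∀ᶠ n : ℕ in atTop, s / n ∈ Icc (0 : ℝ) 1 := fun s hs => by
    filter_upwards [tendsto_natCast_atTop_atTop.eventually_ge_atTop s,
      eventually_gt_atTop 0] with n hn hn0
    have : (0 : ℝ) < n := Nat.cast_pos.2 hn0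
    exact ⟨by positivity, (div_le_one this).2 hn⟩
  have hclose : ∀ s : ℝ, 0 ≤ s →
      ∀ᶠ n : ℕ in atTop, dist (γ n (s / n)) (ρ.toFun s) ≤ dist q (ρ.toFun 0) := fun s hs => by
    filter_upwards [hmem s hs, eventually_gt_atTop 0] with n hn hn0
    have hn' : (n : ℝ) ≠ 0 := Nat.cast_ne_zero.2 hn0.ne'
    have h := (hγ n).dist_le_of_common_end_s4
      (ρ.isGeodesicSeg le_rfl (Nat.cast_nonneg n)) hn
    simpa [div_mul_cancel₀ s hn'] using h
  have hlim : ∀ s : ℝ, ∃ z : X, 0 ≤ s → Tendsto (fun n : ℕ => γ n (s / n)) U (nhds z) := by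
    intro s
    by_cases hs : 0 ≤ s
    · have hK : ((U.map fun n : ℕ => γ n (s / n) : Ultrafilter X) : Filter X) ≤
          𝓟 (closedBall (ρ.toFun s) (dist q (ρ.toFun 0))) := by
        rw [le_principal_iff]
        exact hU (hclose s hs)
      obtain ⟨z, -, hz⟩ := (isCompact_closedBall _ _).ultrafilter_le_nhds _ hK
      exact ⟨z, fun _ => hz⟩
    · exact ⟨q, fun h => absurd h hs⟩
  choose f hf using hlim
  have hB : Tendsto (fun n : ℕ => dist q (ρ.toFun n) - n) atTop (nhds (busemann ρ q)) := by
    simpa only [dist_comm q, Function.comp_def] using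
      (tendsto_busemann ρ q).comp tendsto_natCast_atTop_atTop
  have hratio : Tendsto (fun n : ℕ => dist q (ρ.toFun n) / n) atTop (nhds 1) := by
    have h := (hB.mul (tendsto_inv_atTop_nhds_zero_nat (𝕜 := ℝ))).add_const 1
    rw [mul_zero, zero_add] at h
    refine h.congr' ?_
    filter_upwards [eventually_gt_atTop 0] with n hn
    have hn' : (n : ℝ) ≠ 0 := Nat.cast_ne_zero.2 hn.ne'
    field_simp
    ring
  have hisom : ∀ s, 0 ≤ s → ∀ t, 0 ≤ t → dist (f s) (f t) = |s - t| := fun s hs t ht => by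
    have h₁ := (hf s hs).dist (hf t ht)
    have h₂ : Tendsto (fun n : ℕ => |s - t| * (dist q (ρ.toFun n) / n)) U (nhds (|s - t| * 1)) :=
      (hratio.const_mul _).mono_left hU
    rw [mul_one] at h₂
    refine tendsto_nhds_unique h₁ (h₂.congr' (hU ?_))
    filter_upwards [hmem s hs, hmem t ht] with n hns hnt
    rw [(hγ n).2.2 _ hns _ hnt, ← sub_div, abs_div, Nat.abs_cast]
    ring
  refine ⟨⟨f, hisom⟩, ?_, ?_, ?_⟩
  · have h := hf 0 le_rfl
    simp only [zero_div, (hγ _).1] at h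
    exact tendsto_nhds_unique h tendsto_const_nhds
  · exact Quotient.sound ⟨dist q (ρ.toFun 0), fun s hs =>
      le_of_tendsto ((hf s hs).dist tendsto_const_nhds) (hU (hclose s hs))⟩
  · intro s hs
    have h₁ : Tendsto (fun n : ℕ => busemann ρ (γ n (s / n))) U (nhds (busemann ρ (f s))) :=
      ((continuous_busemann ρ).tendsto _).comp (hf s hs)
    have h₂ := (hB.sub (hratio.const_mul s)).mono_left hU
    rw [mul_one] at h₂
    refine le_of_tendsto_of_tendsto h₁ h₂ (hU ?_)
    filter_upwards [hmem s hs] with n hn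
    have h := busemann_le ρ (γ n (s / n)) (Nat.cast_nonneg n)
    have h₃ := (hγ n).2.2 1 ⟨zero_le_one, le_rfl⟩ _ hn
    rw [(hγ n).2.1, abs_of_nonneg (sub_nonneg.2 hn.2)] at h₃
    rw [h₃] at h
    refine h.trans (le_of_eq ?_)
    ring

end Rays

section Horoballs

variable [MetricSpace X]

theorem exists_busemann_le_of_dist_le [CAT0Space X] (ρ : GeodesicRay X) (q : X) {c M : ℝ}
    (hcM : c ≤ M) (hq : busemann ρ q ≤ M) :
    ∃ y, busemann ρ y ≤ c ∧ dist q y ≤ M - c + 1 := by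
  have hev := (tendsto_busemann ρ q).eventually_lt_const
    (show busemann ρ q < M + 1 by linarith)
  have hev' := (tendsto_atTop_add_const_right atTop (-dist (ρ.toFun 0) q)
    tendsto_id).eventually_ge_atTop (M - c + 1)
  obtain ⟨t, ⟨ht₁, ht₂⟩, ht₀⟩ := ((hev.and hev').and (eventually_ge_atTop (0 : ℝ))).exists
  obtain ⟨γ, hγ⟩ := CAT0Space.exists_geodesic q (ρ.toFun t)
  have htri := dist_triangle_right (ρ.toFun t) (ρ.toFun 0) q
  rw [ρ.dist_zero ht₀, dist_comm (ρ.toFun t) q] at htri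
  rw [dist_comm] at ht₁
  simp only [id] at ht₂
  set L := dist q (ρ.toFun t)
  set D := M - c + 1 with hD
  have hDpos : 0 < D := by linarith
  have hL : D ≤ L := by linarith
  have hLpos : 0 < L := hDpos.trans_le hL
  have hmem : D / L ∈ Icc (0 : ℝ) 1 := ⟨by positivity, (div_le_one hLpos).2 hL⟩
  have hDL : D / L * L = D := div_mul_cancel₀ _ hLpos.ne'
  have h₀ := hγ.2.2 0 ⟨le_rfl, zero_le_one⟩ _ hmem
  have h₁ := hγ.2.2 1 ⟨zero_le_one, le_rfl⟩ _ hmem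
  rw [hγ.1, zero_sub, abs_neg, abs_of_nonneg hmem.1, hDL] at h₀
  rw [hγ.2.1, abs_of_nonneg (sub_nonneg.2 hmem.2), sub_mul, hDL, one_mul] at h₁
  refine ⟨γ (D / L), ?_, h₀.le⟩
  have h := busemann_le ρ (γ (D / L)) ht₀
  linarith

theorem titsAngle_le_of_mem_boundarySet (ρ : GeodesicRay X) (c : ℝ) {η : Boundary X}
    (hη : η ∈ boundarySet {y : X | busemann ρ y ≤ c}) :
    titsAngle ρ.cls η ≤ Real.pi / 2 := by
  obtain ⟨τ, rfl, C, hC⟩ := hη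
  refine Real.sSup_le ?_ (by positivity)
  rintro _ ⟨ρ', σ', h₀, hρ', hσ', rfl⟩
  by_contra! hang
  obtain ⟨δ, hδ, hdiv⟩ := exists_sq_add_le_of_pi_div_two_lt ρ' σ' h₀ hang
  obtain ⟨C₁, hC₁⟩ : ρ'.Asymp ρ := Quotient.exact hρ'
  obtain ⟨C₂, hC₂⟩ : σ'.Asymp τ := Quotient.exact hσ'
  obtain ⟨K, hK⟩ : ∃ K, K = C₁ + C₂ + C + c + 1 := ⟨_, rfl⟩
  have ht : 0 < (|K| + 1) / δ := by positivity
  set t := (|K| + 1) / δ with ht_def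
  have htδ : t * δ = |K| + 1 := div_mul_cancel₀ _ hδ.ne'
  obtain ⟨y, hy, hyt⟩ := hC t ht.le
  have hev := (tendsto_busemann ρ y).eventually_lt_const
    (show busemann ρ y < c + 1 from lt_of_le_of_lt hy (by linarith))
  obtain ⟨s, hs₁, hs₂⟩ := (hev.and (eventually_gt_atTop (K ^ 2))).exists
  have hs : 0 < s := lt_of_le_of_lt (sq_nonneg K) hs₂
  have hle : dist (ρ'.toFun s) (σ'.toFun t) ≤ s + K := by
    have h₁ := dist_triangle4 (ρ'.toFun s) (ρ.toFun s) y (σ'.toFun t)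
    have h₂ := dist_triangle_left y (σ'.toFun t) (τ.toFun t)
    rw [dist_comm (τ.toFun t) (σ'.toFun t)] at h₂
    linarith [hC₁ s hs.le, hC₂ t ht.le]
  have hsq := pow_le_pow_left₀ dist_nonneg hle 2
  have h := hdiv s hs t ht
  have hst : 2 * s * t * δ = 2 * s * (|K| + 1) := by rw [← htδ]; ring
  nlinarith [mul_nonneg hs.le (sub_nonneg.2 (le_abs_self K)), sq_nonneg t]

/-- Along a ray making Tits angle at most `π / 2` with the centre, the Busemann function has
nonpositive upper right derivative. -/
theorem exists_busemann_le_add_mul [ProperSpace X] [CAT0Space X] (ρ σ : GeodesicRay X)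
    (hang : titsAngle ρ.cls σ.cls ≤ Real.pi / 2) {t ε : ℝ} (ht : 0 ≤ t) (hε : 0 < ε) :
    ∃ r₀ > 0, ∀ r, 0 < r → r < r₀ →
      busemann ρ (σ.toFun (t + r)) < busemann ρ (σ.toFun t) + ε * r := by
  obtain ⟨ρ', h₀, hcls, hdec⟩ := exists_asymptotic_ray ρ (σ.toFun t)
  have h₀' : ρ'.toFun 0 = (σ.shift t ht).toFun 0 := by
    rw [h₀]; exact congrArg σ.toFun (add_zero t).symm
  have hang' := alexAngleRays_le_titsAngle ρ' (σ.shift t ht) h₀'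
  rw [hcls, GeodesicRay.cls_shift] at hang'
  obtain ⟨s, hs, u, hu, hsu⟩ := exists_dist_sq_le_of_le_pi_div_two ρ' (σ.shift t ht) h₀'
    (hang'.trans hang) (half_pos hε)
  change dist (ρ'.toFun s) (σ.toFun (t + u)) ^ 2 ≤ _ at hsu
  refine ⟨min u (s * ε), lt_min hu (by positivity), fun r hr hrlt => ?_⟩
  obtain ⟨hru, hrs⟩ := lt_min_iff.1 hrlt
  have hmem : r / u ∈ Icc (0 : ℝ) 1 := ⟨by positivity, (div_le_one hu).2 hru.le⟩
  have hcmp := CAT0Space.comparison (ρ'.toFun s) _ _ _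
    (σ.isGeodesicSeg ht (le_add_of_nonneg_right hu.le)) (r / u) hmem
  have hru' : r / u * u = r := div_mul_cancel₀ _ hu.ne'
  have hbase : dist (ρ'.toFun s) (σ.toFun t) = s := by rw [← h₀, ρ'.dist_zero hs.le]
  have hlen : dist (σ.toFun t) (σ.toFun (t + u)) = u := by
    rw [σ.isom t ht _ (add_nonneg ht hu.le), sub_add_cancel_left, abs_neg, abs_of_pos hu]
  rw [add_sub_cancel_left, hru', hbase, hlen] at hcmp
  have hmul := mul_le_mul_of_nonneg_left hsu hmem.1
  have hd : dist (ρ'.toFun s) (σ.toFun (t + r)) ^ 2 ≤ s ^ 2 + r ^ 2 + s * r * ε := by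
    have hid : (1 - r / u) * s ^ 2 + r / u * (s ^ 2 + u ^ 2 + 2 * s * u * (ε / 2)) -
        r / u * (1 - r / u) * u ^ 2 = s ^ 2 + r ^ 2 + s * r * ε := by
      field_simp
      ring
    linarith
  have hlt : dist (ρ'.toFun s) (σ.toFun (t + r)) < s + ε * r := by
    refine lt_of_pow_lt_pow_left₀ 2 (by positivity) (hd.trans_lt ?_)
    nlinarith [mul_lt_mul_of_pos_left hrs hr, sq_nonneg (ε * r)]
  have h₁ := busemann_le_add_dist ρ (ρ'.toFun s) (σ.toFun (t + r))
  linarith [hdec s hs.le]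

theorem busemann_le_of_titsAngle_le [ProperSpace X] [CAT0Space X] (ρ σ : GeodesicRay X)
    (hang : titsAngle ρ.cls σ.cls ≤ Real.pi / 2) {t : ℝ} (ht : 0 ≤ t) :
    busemann ρ (σ.toFun t) ≤ busemann ρ (σ.toFun 0) := by
  have hσ : ContinuousOn σ.toFun (Icc 0 t) := by
    refine (LipschitzOnWith.of_dist_le_mul (K := 1) fun x hx y hy => ?_).continuousOn
    rw [σ.isom x hx.1 y hy.1, NNReal.coe_one, one_mul, Real.dist_eq]
  refine image_le_of_liminf_slope_right_le_deriv_boundary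
    (f := fun t => busemann ρ (σ.toFun t)) (B := fun _ => busemann ρ (σ.toFun 0))
    (B' := fun _ => 0) ((continuous_busemann ρ).comp_continuousOn hσ) le_rfl
    continuousOn_const (fun x _ => hasDerivWithinAt_const _ _ _) (fun x hx ε hε => ?_)
    (right_mem_Icc.2 ht)
  obtain ⟨r₀, hr₀, hr⟩ := exists_busemann_le_add_mul ρ σ hang hx.1 hε
  refine Eventually.frequently ?_
  filter_upwards [Ioo_mem_nhdsGT (show x < x + r₀ by linarith)] with z hz
  have h := hr (z - x) (by linarith [hz.1]) (by linarith [hz.2])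
  rw [add_sub_cancel] at h
  rw [slope_def_field, div_lt_iff₀ (by linarith [hz.1])]
  linarith

end Horoballs

/-- the boundary of a closed horoball centred at `ξ` is the closed Tits
ball of radius `π/2` centred at `ξ`. -/
theorem stmt4 (X : Type u) [MetricSpace X] [ProperSpace X] [CAT0Space X]
    (ρ : GeodesicRay X) (c : ℝ) :
    boundarySet {y : X | busemann ρ y ≤ c} =
      {η : Boundary X | titsAngle ρ.cls η ≤ Real.pi / 2} := by
  refine Subset.antisymm (fun η hη => titsAngle_le_of_mem_boundarySet ρ c hη) fun η hη => ?_
  obtain ⟨σ, rfl⟩ : ∃ σ : GeodesicRay X, σ.cls = η := Quotient.exists_rep η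
  refine ⟨σ, rfl, max c (busemann ρ (σ.toFun 0)) - c + 1, fun t ht => ?_⟩
  exact exists_busemann_le_of_dist_le ρ (σ.toFun t) (le_max_left _ _)
    ((busemann_le_of_titsAngle_le ρ σ hη ht).trans (le_max_right _ _))
end
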